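/- Let ρ, T > 0, x, y ∈ ℝ, θ = 1/4, and define on [0,T] the deterministic functions X*_t = ((x+y)/2)V_t + ((x-y)/2)W_t and Y*_t = ((x+y)/2)V_t - ((x-y)/2)W_t, where V_t = (e^{3ρT}(6ρ(T-t)+4) - 4e^{3ρt})/(2e^{3ρT}(3ρT+5) - 1) with V_{0-} = 1, and W_t = (ρ(T-t)+1)/(ρT+1) for t ∈ [0,T), W_{0-} = 1, W_T = 0. Then for every t ∈ [0,T], ∫_{[0,T]} e^{-ρ|t-s|} dX*_s + ∫_{[0,t)} e^{-ρ(t-s)} dY*_s + (1/2)ΔY*_t + 2θ ΔX*_t = -(1/2)( (x-y)/(ρT+1) + 18(x+y)/(10 + 6ρT - e^{-3ρT}) ), a constant independent of t. -/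

import Mathlib

open Real MeasureTheory

/-- Integral of an affine function of `exp (3ρs)` against the kernel decaying backwards in time. -/
theorem setIntegral_exp_backward {ρ : ℝ} (hρ : ρ ≠ 0) (p q : ℝ) {t : ℝ} (ht : 0 ≤ t) :
    (∫ s in Set.Ioo (0:ℝ) t, Real.exp (-ρ*(t-s)) * (p + q * Real.exp (3*ρ*s)))
      = (p/ρ + q/(4*ρ) * Real.exp (3*ρ*t)) - Real.exp (-ρ*t) * (p/ρ + q/(4*ρ)) := by
  rw [← integral_Ioc_eq_integral_Ioo, ← intervalIntegral.integral_of_le ht]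
  rw [intervalIntegral.integral_eq_sub_of_hasDerivAt
    (f := fun s => Real.exp (-ρ*(t-s)) * (p/ρ + q/(4*ρ) * Real.exp (3*ρ*s)))]
  · simp
  · intro s _
    have h1 : HasDerivAt (fun s => Real.exp (-ρ*(t-s))) (Real.exp (-ρ*(t-s)) * (-ρ*(-1))) s :=
      (((hasDerivAt_id s).const_sub t).const_mul (-ρ)).exp
    have h2 : HasDerivAt (fun s => Real.exp (3*ρ*s)) (Real.exp (3*ρ*s) * (3*ρ*1)) s :=
      ((hasDerivAt_id s).const_mul (3*ρ)).exp
    refine (h1.mul ((h2.const_mul (q/(4*ρ))).const_add (p/ρ))).congr_deriv ?_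
    field_simp
    ring
  · exact Continuous.intervalIntegrable (by fun_prop) _ _

/-- Integral of an affine function of `exp (3ρs)` against the kernel decaying forwards in time. -/
theorem setIntegral_exp_forward {ρ : ℝ} (hρ : ρ ≠ 0) (p q : ℝ) {t T : ℝ} (ht : t ≤ T) :
    (∫ s in Set.Ioo t T, Real.exp (-ρ*(s-t)) * (p + q * Real.exp (3*ρ*s)))
      = Real.exp (-ρ*(T-t)) * (-p/ρ + q/(2*ρ) * Real.exp (3*ρ*T))
        - (-p/ρ + q/(2*ρ) * Real.exp (3*ρ*t)) := by
  rw [← integral_Ioc_eq_integral_Ioo, ← intervalIntegral.integral_of_le ht]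
  rw [intervalIntegral.integral_eq_sub_of_hasDerivAt
    (f := fun s => Real.exp (-ρ*(s-t)) * (-p/ρ + q/(2*ρ) * Real.exp (3*ρ*s)))]
  · simp
  · intro s _
    have h1 : HasDerivAt (fun s => Real.exp (-ρ*(s-t))) (Real.exp (-ρ*(s-t)) * (-ρ*1)) s :=
      (((hasDerivAt_id s).sub_const t).const_mul (-ρ)).exp
    have h2 : HasDerivAt (fun s => Real.exp (3*ρ*s)) (Real.exp (3*ρ*s) * (3*ρ*1)) s :=
      ((hasDerivAt_id s).const_mul (3*ρ)).exp
    refine (h1.mul ((h2.const_mul (q/(2*ρ))).const_add (-p/ρ))).congr_deriv ?_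
    field_simp
    ring
  · exact Continuous.intervalIntegrable (by fun_prop) _ _

/-- Integral of an affine function of `exp (3ρs)` against the two-sided exponential kernel. -/
theorem setIntegral_exp_abs {ρ : ℝ} (hρ : ρ ≠ 0) (p q : ℝ) {t T : ℝ}
    (h0 : 0 ≤ t) (hT : t ≤ T) :
    (∫ s in Set.Ioo (0:ℝ) T, Real.exp (-ρ*|t-s|) * (p + q * Real.exp (3*ρ*s)))
      = ((p/ρ + q/(4*ρ) * Real.exp (3*ρ*t)) - Real.exp (-ρ*t) * (p/ρ + q/(4*ρ)))
        + (Real.exp (-ρ*(T-t)) * (-p/ρ + q/(2*ρ) * Real.exp (3*ρ*T))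
        - (-p/ρ + q/(2*ρ) * Real.exp (3*ρ*t))) := by
  have hc : Continuous fun s => Real.exp (-ρ*|t-s|) * (p + q * Real.exp (3*ρ*s)) := by fun_prop
  rw [← setIntegral_exp_backward hρ p q h0, ← setIntegral_exp_forward hρ p q hT,
    ← integral_Ioc_eq_integral_Ioo, ← intervalIntegral.integral_of_le (h0.trans hT),
    ← intervalIntegral.integral_add_adjacent_intervals (hc.intervalIntegrable 0 t)
      (hc.intervalIntegrable t T),
    intervalIntegral.integral_of_le h0, intervalIntegral.integral_of_le hT,
    integral_Ioc_eq_integral_Ioo, integral_Ioc_eq_integral_Ioo]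
  congr 1
  · refine setIntegral_congr_fun measurableSet_Ioo fun s hs => ?_
    simp only [abs_of_nonneg (sub_nonneg.2 hs.2.le)]
  · refine setIntegral_congr_fun measurableSet_Ioo fun s hs => ?_
    simp only [abs_of_nonpos (sub_nonpos.2 hs.1.le), neg_sub]

/-- First-order (Fredholm) condition for the continuous-time Nash equilibrium at the
critical transaction cost level `θ = 1/4`.  The Lebesgue–Stieltjes integrals against
the equilibrium strategies `X* = ((x+y)/2)V + ((x-y)/2)W` and
`Y* = ((x+y)/2)V - ((x-y)/2)W` are written out through their jump parts (at `t = 0`,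
from the initial values `x` resp. `y`, and at `t = T`, down to `0`) and their
absolutely continuous parts (with density `deriv Xf` resp. `deriv Yf` on `(0,T)`). -/
theorem continuous_time_fredholm_condition (ρ T x y : ℝ)
    (hρ : 0 < ρ) (hT : 0 < T)
    (V W Xf Yf : ℝ → ℝ)
    (hV : ∀ t, V t = (Real.exp (3*ρ*T)*(6*ρ*(T-t)+4) - 4*Real.exp (3*ρ*t))
        / (2*Real.exp (3*ρ*T)*(3*ρ*T+5) - 1))
    (hW : ∀ t, W t = (ρ*(T-t)+1)/(ρ*T+1))
    (hX : ∀ t, Xf t = (x+y)/2 * V t + (x-y)/2 * W t)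
    (hY : ∀ t, Yf t = (x+y)/2 * V t - (x-y)/2 * W t)
    (ΔX ΔY : ℝ → ℝ)
    (hΔX : ∀ t, ΔX t = if t = 0 then Xf 0 - x else if t = T then 0 - Xf T else 0)
    (hΔY : ∀ t, ΔY t = if t = 0 then Yf 0 - y else if t = T then 0 - Yf T else 0) :
    ∀ t ∈ Set.Icc (0:ℝ) T,
      -- ∫_{[0,T]} e^{-ρ|t-s|} dX*_s :
      (Real.exp (-ρ*t) * (Xf 0 - x)
          + (∫ s in Set.Ioo (0:ℝ) T, Real.exp (-ρ*|t-s|) * deriv Xf s)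
          + Real.exp (-ρ*(T-t)) * (0 - Xf T))
        -- ∫_{[0,t)} e^{-ρ(t-s)} dY*_s :
        + ((if 0 < t then Real.exp (-ρ*t) * (Yf 0 - y) else 0)
          + (∫ s in Set.Ioo (0:ℝ) t, Real.exp (-ρ*(t-s)) * deriv Yf s))
        + (1/2) * ΔY t + 2*(1/4) * ΔX t
      = -(1/2) * ((x-y)/(ρ*T+1) + 18*(x+y)/(10 + 6*ρ*T - Real.exp (-3*ρ*T))) := by
  rintro t ⟨h0, h1⟩
  have hρ' : ρ ≠ 0 := hρ.ne'
  have hn : ρ*T+1 ≠ 0 := by positivity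
  have hE : 1 < Real.exp (ρ*T) := Real.one_lt_exp_iff.2 (by positivity)
  have e3 : ∀ s, Real.exp (3*ρ*s) = Real.exp (ρ*s)^3 := fun s => by
    rw [← Real.exp_nat_mul]; congr 1; push_cast; ring
  have eneg : ∀ s, Real.exp (-ρ*s) = (Real.exp (ρ*s))⁻¹ := fun s => by
    rw [← Real.exp_neg]; congr 1; ring
  have esub : Real.exp (-ρ*(T-t)) = Real.exp (ρ*t) / Real.exp (ρ*T) := by
    rw [← Real.exp_sub]; congr 1; ring
  have eneg3 : Real.exp (-3*ρ*T) = (Real.exp (ρ*T)^3)⁻¹ := by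
    rw [← e3, ← Real.exp_neg]; congr 1; ring
  have hD : 2*Real.exp (3*ρ*T)*(3*ρ*T+5) - 1 ≠ 0 := by
    have h3 : 1 < Real.exp (3*ρ*T) := Real.one_lt_exp_iff.2 (by positivity)
    have hm : 0 < 3*ρ*T := by positivity
    nlinarith [mul_pos hm (zero_lt_one.trans h3)]
  set D := 2*Real.exp (3*ρ*T)*(3*ρ*T+5) - 1 with hDdef
  have dV : ∀ s, HasDerivAt V ((Real.exp (3*ρ*T)*(-6*ρ) - 12*ρ*Real.exp (3*ρ*s))/D) s := by
    intro s
    rw [funext hV]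
    have g1 : HasDerivAt (fun s => Real.exp (3*ρ*s)) (Real.exp (3*ρ*s) * (3*ρ*1)) s :=
      ((hasDerivAt_id s).const_mul (3*ρ)).exp
    have g2 : HasDerivAt (fun s => 6*ρ*(T-s)+4) (6*ρ*(-1)) s :=
      (((hasDerivAt_id s).const_sub T).const_mul (6*ρ)).add_const 4
    refine (((g2.const_mul (Real.exp (3*ρ*T))).sub (g1.const_mul 4)).div_const D).congr_deriv ?_
    ring
  have dW : ∀ s, HasDerivAt W (-ρ/(ρ*T+1)) s := by
    intro s
    rw [funext hW]
    have g2 : HasDerivAt (fun s => ρ*(T-s)+1) (ρ*(-1)) s :=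
      (((hasDerivAt_id s).const_sub T).const_mul ρ).add_const 1
    refine (g2.div_const (ρ*T+1)).congr_deriv ?_
    ring
  have dX : ∀ s, deriv Xf s = ((x+y)/2*(-6*ρ*Real.exp (3*ρ*T)/D) - (x-y)/2*(ρ/(ρ*T+1)))
      + (x+y)/2*(-12*ρ/D) * Real.exp (3*ρ*s) := by
    intro s
    rw [funext hX]
    refine (((dV s).const_mul ((x+y)/2)).add ((dW s).const_mul ((x-y)/2))).deriv.trans ?_
    ring
  have dY : ∀ s, deriv Yf s = ((x+y)/2*(-6*ρ*Real.exp (3*ρ*T)/D) + (x-y)/2*(ρ/(ρ*T+1)))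
      + (x+y)/2*(-12*ρ/D) * Real.exp (3*ρ*s) := by
    intro s
    rw [funext hY]
    refine (((dV s).const_mul ((x+y)/2)).sub ((dW s).const_mul ((x-y)/2))).deriv.trans ?_
    ring
  have hV0 : V 0 = (Real.exp (3*ρ*T)*(6*ρ*T+4) - 4)/D := by simp [hV, hDdef]
  have hVT : V T = 0 := by simp [hV]; left; ring
  have hW0 : W 0 = 1 := by simp [hW, hn]
  have hWT : W T = 1/(ρ*T+1) := by simp [hW]
  have hR : 10 + 6*ρ*T - Real.exp (-3*ρ*T) = D / Real.exp (ρ*T)^3 := by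
    rw [hDdef, eneg3, e3]
    field_simp
    ring
  have hDE : 6*ρ*T*Real.exp (ρ*T)^3 = D + 1 - 10*Real.exp (ρ*T)^3 := by
    rw [hDdef, e3]; ring
  simp only [dX, dY]
  rw [setIntegral_exp_abs hρ' _ _ h0 h1, setIntegral_exp_backward hρ' _ _ h0, hR,
    hΔX, hΔY, hX 0, hX T, hY 0, hY T, hV0, hVT, hW0, hWT]
  simp only [e3, esub, eneg]
  have hV0' : (Real.exp (ρ*T)^3*(6*ρ*T+4) - 4)/D = 1 - (6*Real.exp (ρ*T)^3 + 3)/D := by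
    field_simp
    linear_combination hDE
  rw [hV0']
  have hEp := Real.exp_pos (ρ*T)
  have htp := Real.exp_pos (ρ*t)
  clear_value D
  rcases h0.eq_or_lt with rfl | h0'
  · simp only [lt_irrefl, if_true, if_false, mul_zero, Real.exp_zero]
    generalize Real.exp (ρ*T) = E at *
    generalize ρ*T+1 = n at *
    field_simp
    ring
  · rcases h1.eq_or_lt with rfl | h1'
    · simp only [h0', h0'.ne', if_true, if_false]
      generalize Real.exp (ρ*t) = E at *
      generalize ρ*t+1 = n at *
      field_simp
      ring
    · simp only [h0', h0'.ne', h1'.ne, if_true, if_false]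
      generalize Real.exp (ρ*T) = E at *
      generalize Real.exp (ρ*t) = a at *
      generalize ρ*T+1 = n at *
      field_simp
      ring
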